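/- The Takagi singular measure μ_S satisfies: μ_S([0,1]) = μ_S(Ω^L) = 1; μ_S is mutually singular with respect to Lebesgue measure; the topological support of μ_S equals the deficient digit set Ω^L; and for every Borel set K ⊆ [0,1], μ_S(K) equals the Lebesgue measure of the image τ^S(K). -/

import Mathlib

open MeasureTheory Set

/-- Distance from a real number to the nearest integer. -/
noncomputable def distNearestInt (t : ℝ) : ℝ := |t - round t|

/-- The Takagi function. -/
noncomputable def takagi (x : ℝ) : ℝ := ∑' n : ℕ, distNearestInt (2 ^ n * x) / 2 ^ n

/-- The `j`-th binary digit of `x ∈ [0,1)` (binary expansion terminating in `0^∞`). -/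
noncomputable def bdigit (x : ℝ) (j : ℕ) : ℤ := ⌊(2 : ℝ) ^ j * x⌋ - 2 * ⌊(2 : ℝ) ^ (j - 1) * x⌋

/-- The deficient digit function `D_j(x) = j - 2(b_1(x) + ⋯ + b_j(x))`. -/
noncomputable def defDigit (x : ℝ) (j : ℕ) : ℤ := (j : ℤ) - 2 * ∑ i ∈ Finset.Icc 1 j, bdigit x i

/-- The deficient digit set `Ω^L`. -/
noncomputable def OmegaL : Set ℝ := {x | x ∈ Set.Ico (0 : ℝ) 1 ∧ ∀ j : ℕ, 1 ≤ j → 0 ≤ defDigit x j}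

/-- The set `½Ω^L = {x ∈ [0,1) : D_j(x) > 0 for all j ≥ 1}`. -/
noncomputable def halfOmegaL : Set ℝ :=
  {x | x ∈ Set.Ico (0 : ℝ) 1 ∧ ∀ j : ℕ, 1 ≤ j → 0 < defDigit x j}

/-- The Takagi singular function. -/
noncomputable def takagiS (x : ℝ) : ℝ := sSup {y | ∃ t ∈ OmegaL, t ≤ x ∧ y = takagi t + t}

/-- `Ω^L_∞`: points of `Ω^L` with infinitely many balance points. -/
noncomputable def OmegaLinf : Set ℝ :=
  {x ∈ OmegaL | {j : ℕ | 1 ≤ j ∧ defDigit x j = 0}.Infinite}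

/-- `Ω^L_fin = Ω^L \ Ω^L_∞`. -/
noncomputable def OmegaLfin : Set ℝ := OmegaL \ OmegaLinf

/-- `(m, k)` encodes a member `k / 2^(2m)` of the breakpoint set `ℬ'`. -/
noncomputable def breakpoint (m k : ℕ) : Prop :=
  (m = 0 ∧ k = 0) ∨
    (1 ≤ m ∧ 0 < k ∧ k < 2 ^ (2 * m) ∧
      (∀ j : ℕ, 1 ≤ j → j ≤ 2 * m - 1 → 0 ≤ defDigit ((k : ℝ) / 2 ^ (2 * m)) j) ∧
      defDigit ((k : ℝ) / 2 ^ (2 * m)) (2 * m) = 0)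

/-- The fine partition set `Ω^L(B)` for `B = k / 2^(2m)`. -/
noncomputable def fineSet (m k : ℕ) : Set ℝ :=
  {x | ∃ x' ∈ halfOmegaL, x = (k : ℝ) / 2 ^ (2 * m) + x' / 2 ^ (2 * m)}

/-- The set `Γ_{2r}`. -/
noncomputable def Gamma (r : ℕ) : Set ℝ :=
  {x | x ∈ Set.Ico (0 : ℝ) 1 ∧ ∀ j : ℕ, 1 ≤ j →
    ((¬ (2 * r ∣ j) → 0 < defDigit x j) ∧ ((2 * r) ∣ j → defDigit x j = 0))}

/-- The level set `L(y)` of the Takagi function. -/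
noncomputable def levelSet (y : ℝ) : Set ℝ := {x ∈ Set.Icc (0 : ℝ) 1 | takagi x = y}

/-! ### Takagi function basics -/

lemma dni_nonneg (t : ℝ) : 0 ≤ distNearestInt t := abs_nonneg _

lemma dni_le (t : ℝ) : distNearestInt t ≤ 1 / 2 := abs_sub_round t

lemma dni_low {u : ℝ} (h0 : 0 ≤ u) (h1 : u < 1) : distNearestInt (u / 2) = u / 2 := by
  have : round (u / 2) = 0 := by
    rw [round_eq, Int.floor_eq_iff]; push_cast; constructor <;> linarith
  unfold distNearestInt
  rw [this]; simp; linarith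

lemma dni_high {u : ℝ} (h0 : 0 ≤ u) (h1 : u < 1) :
    distNearestInt ((1 + u) / 2) = (1 - u) / 2 := by
  have : round ((1 + u) / 2) = 1 := by
    rw [round_eq, Int.floor_eq_iff]; push_cast; constructor <;> linarith
  unfold distNearestInt
  rw [this, abs_of_nonpos] <;> push_cast <;> linarith

lemma tk_summable (x : ℝ) : Summable fun n : ℕ => distNearestInt (2 ^ n * x) / 2 ^ n := by
  refine Summable.of_nonneg_of_le (fun n => div_nonneg (dni_nonneg _) (by positivity))
    (fun n => ?_) (summable_geometric_two' (1 : ℝ))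
  rw [div_div]
  have := dni_le (2 ^ n * x)
  calc distNearestInt (2 ^ n * x) / 2 ^ n ≤ (1 / 2) / 2 ^ n := by gcongr
    _ = _ := by rw [div_div]

lemma tk_nonneg (x : ℝ) : 0 ≤ takagi x :=
  tsum_nonneg fun n => div_nonneg (dni_nonneg _) (by positivity)

lemma tk_le (x : ℝ) : takagi x ≤ 1 := by
  have h := Summable.tsum_le_tsum (f := fun n : ℕ => distNearestInt (2 ^ n * x) / 2 ^ n)
    (g := fun n : ℕ => (1 : ℝ) / 2 / 2 ^ n) (fun n => by
      have := dni_le (2 ^ n * x)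
      gcongr) (tk_summable x) (summable_geometric_two' 1)
  rw [tsum_geometric_two'] at h
  exact h

lemma tk_step (x : ℝ) : takagi x = distNearestInt x + takagi (2 * x) / 2 := by
  unfold takagi
  rw [(tk_summable x).tsum_eq_zero_add, ← tsum_div_const]
  congr 1
  · simp
  · congr 1; ext n; rw [pow_succ, div_div, mul_assoc]

lemma dni_add_int (x : ℝ) (m : ℤ) : distNearestInt (x + m) = distNearestInt x := by
  unfold distNearestInt
  rw [round_add_intCast]; push_cast; congr 1; ring

lemma tk_per (x : ℝ) : takagi (1 + x) = takagi x := by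
  unfold takagi
  congr 1; ext n
  have := dni_add_int (2 ^ n * x) (2 ^ n)
  push_cast at this
  rw [← this]; congr 2; ring

lemma tk_low {u : ℝ} (h0 : 0 ≤ u) (h1 : u < 1) : takagi (u / 2) = u / 2 + takagi u / 2 := by
  rw [tk_step, dni_low h0 h1]; congr 3; ring

lemma tk_high {u : ℝ} (h0 : 0 ≤ u) (h1 : u < 1) :
    takagi ((1 + u) / 2) = (1 - u) / 2 + takagi u / 2 := by
  rw [tk_step, dni_high h0 h1, ← tk_per u]; congr 3; ring

lemma tk_zero : takagi 0 = 0 := by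
  have := tk_low (u := 0) le_rfl one_pos
  simp at this; linarith

/-! ### Digits -/

lemma dd_zero (x : ℝ) : defDigit x 0 = 0 := by simp [defDigit]

lemma dd_succ (x : ℝ) (j : ℕ) : defDigit x (j + 1) = defDigit x j + 1 - 2 * bdigit x (j + 1) := by
  unfold defDigit
  rw [Finset.sum_Icc_succ_top (by omega)]; push_cast; ring

lemma dd_low {u : ℝ} (h0 : 0 ≤ u) (h1 : u < 1) (j : ℕ) :
    defDigit (u / 2) (j + 1) = 1 + defDigit u j := by
  induction j with
  | zero =>
    rw [dd_succ, dd_zero, dd_zero]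
    have e1 : ⌊u⌋ = 0 := by rw [Int.floor_eq_iff]; simp [h0, h1]
    have e2 : ⌊u / 2⌋ = 0 := by rw [Int.floor_eq_iff]; constructor <;> push_cast <;> linarith
    have e3 : (2 : ℝ) ^ (0 + 1) * (u / 2) = u := by ring
    simp only [bdigit, e3, e1]
    simp [e2]
  | succ j ih =>
    rw [dd_succ, ih, dd_succ u]
    have : bdigit (u / 2) (j + 1 + 1) = bdigit u (j + 1) := by
      simp only [bdigit, Nat.add_sub_cancel]
      have e1 : (2 : ℝ) ^ (j + 1 + 1) * (u / 2) = 2 ^ (j + 1) * u := by ring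
      have e2 : (2 : ℝ) ^ (j + 1) * (u / 2) = 2 ^ j * u := by ring
      rw [e1, e2]
    rw [this]; ring

lemma dd_high {u : ℝ} (h0 : 0 ≤ u) (h1 : u < 1) (j : ℕ) :
    defDigit ((1 + u) / 2) (j + 1) = -1 + defDigit u j := by
  induction j with
  | zero =>
    rw [dd_succ, dd_zero, dd_zero]
    have e1 : ⌊1 + u⌋ = 1 := by rw [Int.floor_eq_iff]; constructor <;> push_cast <;> linarith
    have e2 : ⌊(1 + u) / 2⌋ = 0 := by
      rw [Int.floor_eq_iff]; constructor <;> push_cast <;> linarith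
    have e3 : (2 : ℝ) ^ (0 + 1) * ((1 + u) / 2) = 1 + u := by ring
    simp only [bdigit, e3, e1]
    simp [e2]
  | succ j ih =>
    rw [dd_succ, ih, dd_succ u]
    have : bdigit ((1 + u) / 2) (j + 1 + 1) = bdigit u (j + 1) := by
      simp only [bdigit, Nat.add_sub_cancel]
      have e1 : (2 : ℝ) ^ (j + 1 + 1) * ((1 + u) / 2) = 2 ^ (j + 1) * u + ((2 ^ (j + 1) : ℤ) : ℝ) := by
        push_cast; ring
      have e2 : (2 : ℝ) ^ (j + 1) * ((1 + u) / 2) = 2 ^ j * u + ((2 ^ j : ℤ) : ℝ) := by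
        push_cast; ring
      rw [e1, e2, Int.floor_add_intCast, Int.floor_add_intCast]; ring
    rw [this]; ring

/-- Points whose walk started at `d` stays nonnegative. -/
def AA (d : ℤ) : Set ℝ := {x | x ∈ Set.Ico (0 : ℝ) 1 ∧ ∀ j : ℕ, 0 ≤ d + defDigit x j}

lemma AA_nonneg {d : ℤ} {x : ℝ} (h : x ∈ AA d) : 0 ≤ d := by
  simpa [dd_zero] using h.2 0

lemma AA_zero : AA 0 = OmegaL := by
  ext x
  constructor
  · rintro ⟨h, k⟩; exact ⟨h, fun j _ => by simpa using k j⟩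
  · rintro ⟨h, k⟩
    refine ⟨h, fun j => ?_⟩
    rcases j with _ | j
    · simp [dd_zero]
    · simpa using k (j + 1) (by omega)

lemma AA_low {d : ℤ} (hd : 0 ≤ d) {u : ℝ} (hu : u ∈ AA (d + 1)) : u / 2 ∈ AA d := by
  obtain ⟨⟨h0, h1⟩, k⟩ := hu
  refine ⟨⟨by linarith, by linarith⟩, fun j => ?_⟩
  rcases j with _ | j
  · simpa [dd_zero] using hd
  · rw [dd_low h0 h1]; linarith [k j]

lemma AA_high {d : ℤ} {u : ℝ} (hu : u ∈ AA (d - 1)) : (1 + u) / 2 ∈ AA d := by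
  have hd := AA_nonneg hu
  obtain ⟨⟨h0, h1⟩, k⟩ := hu
  refine ⟨⟨by linarith, by linarith⟩, fun j => ?_⟩
  rcases j with _ | j
  · simp only [dd_zero]; linarith
  · rw [dd_high h0 h1]; linarith [k j]

lemma AA_cases {d : ℤ} {x : ℝ} (hx : x ∈ AA d) :
    (∃ u ∈ AA (d + 1), x = u / 2) ∨ (∃ u ∈ AA (d - 1), x = (1 + u) / 2) := by
  obtain ⟨⟨h0, h1⟩, k⟩ := hx
  rcases lt_or_ge x (1 / 2) with h | h
  · left
    refine ⟨2 * x, ⟨⟨by linarith, by linarith⟩, fun j => ?_⟩, by ring⟩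
    have := dd_low (u := 2 * x) (by linarith) (by linarith) j
    have e : 2 * x / 2 = x := by ring
    rw [e] at this
    linarith [k (j + 1)]
  · right
    refine ⟨2 * x - 1, ⟨⟨by linarith, by linarith⟩, fun j => ?_⟩, by ring⟩
    have := dd_high (u := 2 * x - 1) (by linarith) (by linarith) j
    have e : (1 + (2 * x - 1)) / 2 = x := by ring
    rw [e] at this
    linarith [k (j + 1)]

lemma zero_mem_AA {d : ℤ} (hd : 0 ≤ d) : (0 : ℝ) ∈ AA d := by
  refine ⟨by simp, fun j => ?_⟩
  have : defDigit 0 j = j := by simp [defDigit, bdigit]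
  rw [this]; positivity

/-- The rescaled function on a cylinder. -/
noncomputable def FF (d : ℤ) (s : ℝ) : ℝ := takagi s + (d + 1) * s

lemma FF_low {d : ℤ} {u : ℝ} {e : ℤ} (hu : u ∈ AA e) : FF d (u / 2) = FF (d + 1) u / 2 := by
  unfold FF; rw [tk_low hu.1.1 hu.1.2]; push_cast; ring

lemma FF_high {d : ℤ} {u : ℝ} {e : ℤ} (hu : u ∈ AA e) :
    FF d ((1 + u) / 2) = (d + 2 + FF (d - 1) u) / 2 := by
  unfold FF; rw [tk_high hu.1.1 hu.1.2]; push_cast; ring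

lemma FF_nonneg {d : ℤ} {u : ℝ} (hu : u ∈ AA d) : 0 ≤ FF d u := by
  have h : (0 : ℝ) ≤ d := by exact_mod_cast AA_nonneg hu
  have := tk_nonneg u
  have := hu.1.1
  unfold FF; positivity

lemma FF_zero (d : ℤ) : FF d 0 = 0 := by simp [FF, tk_zero]

lemma FF_le_aux (n : ℕ) : ∀ (d : ℤ) (u : ℝ), u ∈ AA d → FF d u ≤ d + 1 + 1 / 2 ^ n := by
  induction n with
  | zero =>
    intro d u hu
    have h : (0 : ℝ) ≤ d := by exact_mod_cast AA_nonneg hu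
    have := tk_le u
    have := hu.1.2
    unfold FF; simp; nlinarith
  | succ n ih =>
    intro d u hu
    have h : (0 : ℝ) ≤ d := by exact_mod_cast AA_nonneg hu
    have e : (1 : ℝ) / 2 ^ (n + 1) = (1 / 2 ^ n) / 2 := by rw [pow_succ, div_div]
    rcases AA_cases hu with ⟨v, hv, rfl⟩ | ⟨v, hv, rfl⟩
    · rw [FF_low hv]
      have := ih _ _ hv
      push_cast at this
      linarith
    · rw [FF_high hv]
      have := ih _ _ hv
      push_cast at this
      linarith

lemma FF_le {d : ℤ} {u : ℝ} (hu : u ∈ AA d) : FF d u ≤ d + 1 := by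
  refine le_of_forall_pos_le_add fun ε hε => ?_
  obtain ⟨n, hn⟩ := exists_pow_lt_of_lt_one hε (by norm_num : (1 / 2 : ℝ) < 1)
  have := FF_le_aux n d u hu
  rw [one_div_pow] at hn
  linarith

lemma FF_mono_aux (n : ℕ) : ∀ (d : ℤ) (x y : ℝ), x ∈ AA d → y ∈ AA d → 1 / 2 ^ n < y - x →
    FF d x ≤ FF d y := by
  induction n with
  | zero =>
    intro d x y hx hy h
    have := hx.1.1
    have := hy.1.2
    simp at h; linarith
  | succ n ih =>
    intro d x y hx hy h
    have e : (1 : ℝ) / 2 ^ (n + 1) = (1 / 2 ^ n) / 2 := by rw [pow_succ, div_div]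
    have hp : (0 : ℝ) < 1 / 2 ^ n := by positivity
    rcases AA_cases hx with ⟨u, hu, rfl⟩ | ⟨u, hu, rfl⟩ <;>
    rcases AA_cases hy with ⟨v, hv, rfl⟩ | ⟨v, hv, rfl⟩
    · rw [FF_low hu, FF_low hv]
      linarith [ih _ _ _ hu hv (by linarith)]
    · rw [FF_low hu, FF_high hv]
      have a := FF_le hu
      have b := FF_nonneg hv
      push_cast at a
      linarith
    · have := hu.1.1
      have := hv.1.2
      linarith
    · rw [FF_high hu, FF_high hv]
      linarith [ih _ _ _ hu hv (by linarith)]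

lemma FF_mono {d : ℤ} {x y : ℝ} (hx : x ∈ AA d) (hy : y ∈ AA d) (h : x ≤ y) :
    FF d x ≤ FF d y := by
  rcases h.eq_or_lt with rfl | h
  · rfl
  obtain ⟨n, hn⟩ := exists_pow_lt_of_lt_one (sub_pos.2 h) (by norm_num : (1 / 2 : ℝ) < 1)
  rw [one_div_pow] at hn
  exact FF_mono_aux n d x y hx hy hn

lemma FF_dense_aux (n : ℕ) : ∀ (d : ℤ) (y : ℝ), 0 ≤ d → 0 ≤ y → y ≤ d + 1 →
    ∃ s ∈ AA d, |FF d s - y| ≤ (d + n + 1) / 2 ^ n := by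
  induction n with
  | zero =>
    intro d y hd h0 h1
    refine ⟨0, zero_mem_AA hd, ?_⟩
    rw [FF_zero, zero_sub, abs_neg, abs_of_nonneg h0]; simpa using h1
  | succ n ih =>
    intro d y hd h0 h1
    rcases le_or_gt y ((d + 2) / 2) with h | h
    · obtain ⟨s, hs, h2⟩ := ih (d + 1) (2 * y) (by omega) (by linarith) (by push_cast; linarith)
      refine ⟨s / 2, AA_low hd hs, ?_⟩
      rw [FF_low hs]
      have e : FF (d + 1) s / 2 - y = (FF (d + 1) s - 2 * y) / 2 := by ring
      rw [e, abs_div, abs_two, pow_succ, ← div_div]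
      push_cast at h2 ⊢
      have e2 : (d : ℝ) + 1 + n + 1 = d + (n + 1) + 1 := by ring
      rw [e2] at h2
      linarith
    · have hd1 : 1 ≤ d := by
        by_contra hc
        have : d = 0 := by omega
        subst this
        norm_num at h h1
        linarith
      obtain ⟨s, hs, h2⟩ := ih (d - 1) (2 * y - (d + 2)) (by omega) (by linarith)
        (by push_cast; linarith)
      refine ⟨(1 + s) / 2, AA_high hs, ?_⟩
      rw [FF_high hs]
      have e : (d + 2 + FF (d - 1) s) / 2 - y = (FF (d - 1) s - (2 * y - (d + 2))) / 2 := by ring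
      rw [e, abs_div, abs_two, pow_succ, ← div_div]
      push_cast at h2 ⊢
      have e2 : ((d : ℝ) - 1 + n + 1) / 2 ^ n ≤ (d + (n + 1) + 1) / 2 ^ n := by
        gcongr ?_ / _; linarith
      linarith

lemma FF_dense {y ε : ℝ} (h0 : 0 ≤ y) (h1 : y ≤ 1) (hε : 0 < ε) :
    ∃ s ∈ AA 0, |FF 0 s - y| < ε := by
  have h : Filter.Tendsto (fun n : ℕ => ((n : ℝ) + 1) / 2 ^ n) Filter.atTop (nhds 0) := by
    have a := tendsto_pow_const_div_const_pow_of_one_lt 1 (by norm_num : (1 : ℝ) < 2)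
    have b := tendsto_pow_const_div_const_pow_of_one_lt 0 (by norm_num : (1 : ℝ) < 2)
    have := a.add b
    simp only [pow_one, pow_zero, add_zero] at this
    refine this.congr fun n => by rw [add_div]
  obtain ⟨n, hn⟩ := (h.eventually (gt_mem_nhds hε)).exists
  obtain ⟨s, hs, h2⟩ := FF_dense_aux n 0 y le_rfl h0 (by simpa using h1)
  refine ⟨s, hs, lt_of_le_of_lt h2 ?_⟩
  simpa using hn

lemma FF_strict (n : ℕ) : ∀ (d : ℤ) (x : ℝ), x ∈ AA d → ∃ s ∈ AA d, ∃ t ∈ AA d,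
    |s - x| ≤ 1 / 2 ^ n ∧ |t - x| ≤ 1 / 2 ^ n ∧ s < t ∧ FF d s < FF d t := by
  induction n with
  | zero =>
    intro d x hx
    have hd := AA_nonneg hx
    have hq : (1 + 0) / 2 / 2 ∈ AA d := AA_low hd (AA_high (zero_mem_AA (by omega)))
    have h0 := hx.1.1
    have h1 := hx.1.2
    refine ⟨0, zero_mem_AA hd, _, hq, ?_, ?_, by norm_num, ?_⟩
    · rw [abs_le]; constructor <;> simp <;> linarith
    · rw [abs_le]; constructor <;> norm_num <;> linarith
    · rw [FF_zero]
      have h : (0 : ℝ) ≤ d := by exact_mod_cast hd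
      have := tk_nonneg ((1 + 0) / 2 / 2)
      unfold FF
      positivity
  | succ n ih =>
    intro d x hx
    have hd := AA_nonneg hx
    rcases AA_cases hx with ⟨u, hu, rfl⟩ | ⟨u, hu, rfl⟩
    · obtain ⟨s, hs, t, ht, a, b, c, e⟩ := ih _ _ hu
      refine ⟨s / 2, AA_low hd hs, t / 2, AA_low hd ht, ?_, ?_, by linarith, ?_⟩
      · rw [← sub_div, abs_div, abs_two, pow_succ, ← div_div]; linarith
      · rw [← sub_div, abs_div, abs_two, pow_succ, ← div_div]; linarith
      · rw [FF_low hs, FF_low ht]; linarith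
    · obtain ⟨s, hs, t, ht, a, b, c, e⟩ := ih _ _ hu
      refine ⟨(1 + s) / 2, AA_high hs, (1 + t) / 2, AA_high ht, ?_, ?_, by linarith, ?_⟩
      · rw [← sub_div, abs_div, abs_two, pow_succ, ← div_div, add_sub_add_left_eq_sub]; linarith
      · rw [← sub_div, abs_div, abs_two, pow_succ, ← div_div, add_sub_add_left_eq_sub]; linarith
      · rw [FF_high hs, FF_high ht]; linarith

/-! ### Closedness and Lebesgue measure zero -/

lemma AA_subset {d : ℤ} : AA d ⊆ (fun u : ℝ => u / 2) '' AA (d + 1) ∪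
    (fun u : ℝ => (1 + u) / 2) '' AA (d - 1) := by
  intro x hx
  rcases AA_cases hx with ⟨u, hu, rfl⟩ | ⟨u, hu, rfl⟩
  · exact Or.inl ⟨u, hu, rfl⟩
  · exact Or.inr ⟨u, hu, rfl⟩

lemma AA_lt (n : ℕ) : ∀ x ∈ AA (n : ℤ), x ≤ 1 - 1 / 2 ^ (n + 1) := by
  induction n with
  | zero =>
    intro x hx
    rcases AA_cases hx with ⟨u, hu, rfl⟩ | ⟨u, hu, rfl⟩
    · have := hu.1.2
      norm_num; linarith
    · have := AA_nonneg hu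
      simp at this
  | succ n ih =>
    intro x hx
    have e : (1 : ℝ) / 2 ^ (n + 1 + 1) = (1 / 2 ^ (n + 1)) / 2 := by
      rw [pow_succ _ (n + 1), div_div]
    rcases AA_cases hx with ⟨u, hu, rfl⟩ | ⟨u, hu, rfl⟩
    · have := hu.1.2
      have : (1 : ℝ) / 2 ^ (n + 1 + 1) ≤ 1 / 2 := by
        rw [e]
        have : (1 : ℝ) / 2 ^ (n + 1) ≤ 1 := by
          rw [div_le_one (by positivity)]; exact one_le_pow₀ (by norm_num)
        linarith
      linarith
    · have := ih u (by push_cast at hu; simpa using hu)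
      linarith

lemma clAA_cases {d : ℤ} {x : ℝ} (hx : x ∈ closure (AA d)) : 0 ≤ d ∧ x ∈ Ico (0 : ℝ) 1 ∧
    ((∃ u ∈ closure (AA (d + 1)), x = u / 2) ∨ (∃ u ∈ closure (AA (d - 1)), x = (1 + u) / 2)) := by
  have hd : 0 ≤ d := by
    obtain ⟨y, hy⟩ := closure_nonempty_iff.1 ⟨x, hx⟩
    exact AA_nonneg hy
  refine ⟨hd, ⟨?_, ?_⟩, ?_⟩
  · exact closure_minimal (fun y hy => hy.1.1) isClosed_Ici hx
  · obtain ⟨n, rfl⟩ := Int.eq_ofNat_of_zero_le hd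
    have : x ≤ 1 - 1 / 2 ^ (n + 1) := closure_minimal (AA_lt n) isClosed_Iic hx
    have h : (0 : ℝ) < 1 / 2 ^ (n + 1) := by positivity
    linarith
  · have h := closure_mono AA_subset hx
    rw [closure_union] at h
    rcases h with h | h
    · left
      refine ⟨2 * x, ?_, by ring⟩
      have := map_mem_closure (f := fun x : ℝ => 2 * x) (by fun_prop) h (t := AA (d + 1)) (by
        rintro _ ⟨u, hu, rfl⟩; simpa [mul_div_cancel₀] using hu)
      exact this
    · right
      refine ⟨2 * x - 1, ?_, by ring⟩
      have := map_mem_closure (f := fun x : ℝ => 2 * x - 1) (by fun_prop) h (t := AA (d - 1)) (by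
        rintro _ ⟨u, hu, rfl⟩
        have : 2 * ((1 + u) / 2) - 1 = u := by ring
        simpa [this] using hu)
      exact this

lemma clAA_digit (j : ℕ) : ∀ (d : ℤ) (x : ℝ), x ∈ closure (AA d) → 0 ≤ d + defDigit x j := by
  induction j with
  | zero => intro d x hx; simpa [dd_zero] using (clAA_cases hx).1
  | succ j ih =>
    intro d x hx
    obtain ⟨hd, -, ⟨u, hu, rfl⟩ | ⟨u, hu, rfl⟩⟩ := clAA_cases hx
    · have h := (clAA_cases hu).2.1
      rw [dd_low h.1 h.2]; linarith [ih _ _ hu]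
    · have h := (clAA_cases hu).2.1
      rw [dd_high h.1 h.2]; linarith [ih _ _ hu]

lemma AA_closed (d : ℤ) : IsClosed (AA d) := by
  rw [← closure_subset_iff_isClosed]
  exact fun x hx => ⟨(clAA_cases hx).2.1, fun j => clAA_digit j d x hx⟩

lemma vol_fin (d : ℤ) : volume (AA d) ≤ 1 := by
  calc volume (AA d) ≤ volume (Ico (0 : ℝ) 1) := measure_mono fun x hx => hx.1
    _ = 1 := by simp

open scoped Pointwise in
lemma vol_low (s : Set ℝ) : volume ((fun u : ℝ => u / 2) '' s) = ENNReal.ofReal (1 / 2) * volume s := by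
  have : (fun u : ℝ => u / 2) '' s = (1 / 2 : ℝ) • s := by
    rw [← image_smul]; congr 1; ext u; simp; ring
  rw [this, Measure.addHaar_smul]; simp

lemma vol_high (s : Set ℝ) :
    volume ((fun u : ℝ => (1 + u) / 2) '' s) = ENNReal.ofReal (1 / 2) * volume s := by
  have : (fun u : ℝ => (1 + u) / 2) '' s = (fun u => 1 / 2 + u) '' ((fun u : ℝ => u / 2) '' s) := by
    rw [image_image]; congr 1; ext u; ring
  rw [this, image_add_left, measure_preimage_add, vol_low]

lemma vol_convex (d : ℤ) : 2 * volume.real (AA d) ≤ volume.real (AA (d + 1)) + volume.real (AA (d - 1)) := by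
  have f (d : ℤ) : volume (AA d) ≠ ⊤ := ne_top_of_le_ne_top ENNReal.one_ne_top (vol_fin d)
  have h := (measure_mono (μ := volume) (AA_subset (d := d))).trans (measure_union_le _ _)
  rw [vol_low, vol_high] at h
  have h2 := ENNReal.toReal_mono (by finiteness [f (d + 1), f (d - 1)]) h
  rw [ENNReal.toReal_add (by finiteness [f (d + 1)]) (by finiteness [f (d - 1)]), ENNReal.toReal_mul, ENNReal.toReal_mul,
    ENNReal.toReal_ofReal (by norm_num)] at h2
  simp only [Measure.real]
  linarith

lemma vol_zero : volume (AA 0) = 0 := by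
  have key : ∀ n : ℕ, volume.real (AA 0) ≤ volume.real (AA n) - volume.real (AA ((n : ℤ) - 1)) ∧
      (n + 1) * volume.real (AA 0) ≤ volume.real (AA n) := by
    intro n
    induction n with
    | zero =>
      have : AA (-1) = ∅ := by
        ext x; simp only [mem_empty_iff_false, iff_false]; intro h
        have := AA_nonneg h
        omega
      simp [this]
    | succ n ih =>
      have := vol_convex n
      push_cast
      rw [add_sub_cancel_right]
      constructor <;> linarith
  have b (n : ℕ) : volume.real (AA n) ≤ 1 := by
    have := ENNReal.toReal_mono ENNReal.one_ne_top (vol_fin n)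
    simpa [Measure.real] using this
  have f : volume (AA 0) ≠ ⊤ := ne_top_of_le_ne_top ENNReal.one_ne_top (vol_fin 0)
  by_contra hne
  have hp : 0 < volume.real (AA 0) := ENNReal.toReal_pos hne f
  obtain ⟨n, hn⟩ := exists_nat_gt (1 / volume.real (AA 0))
  rw [div_lt_iff₀ hp] at hn
  have := (key n).2
  have := b n
  linarith

/-! ### The singular function -/

lemma tS_eq (x : ℝ) : takagiS x = sSup (FF 0 '' (AA 0 ∩ Iic x)) := by
  unfold takagiS
  congr 1
  ext y
  rw [← AA_zero]
  constructor
  · rintro ⟨t, h, h2, rfl⟩; exact ⟨t, ⟨h, h2⟩, by simp [FF]⟩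
  · rintro ⟨t, ⟨h, h2⟩, rfl⟩; exact ⟨t, h, h2, by simp [FF]⟩

lemma FF0_le {u : ℝ} (hu : u ∈ AA 0) : FF 0 u ≤ 1 := by simpa using FF_le hu

lemma tS_bdd (x : ℝ) : BddAbove (FF 0 '' (AA 0 ∩ Iic x)) :=
  ⟨1, by rintro _ ⟨t, ⟨h, -⟩, rfl⟩; exact FF0_le h⟩

lemma tS_nonneg (x : ℝ) : 0 ≤ takagiS x := by
  rw [tS_eq]
  apply Real.sSup_nonneg
  rintro _ ⟨t, ⟨h, -⟩, rfl⟩; exact FF_nonneg h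

lemma tS_le (x : ℝ) : takagiS x ≤ 1 := by
  rw [tS_eq]
  apply Real.sSup_le _ zero_le_one
  rintro _ ⟨t, ⟨h, -⟩, rfl⟩; exact FF0_le h

lemma tS_of_mem {x : ℝ} (hx : x ∈ AA 0) : takagiS x = FF 0 x := by
  rw [tS_eq]
  apply le_antisymm
  · apply Real.sSup_le _ (FF_nonneg hx)
    rintro _ ⟨t, ⟨h, h2⟩, rfl⟩; exact FF_mono h hx h2
  · exact le_csSup (tS_bdd x) ⟨x, ⟨hx, self_mem_Iic⟩, rfl⟩

lemma tS_mono : Monotone takagiS := by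
  intro x y h
  rw [tS_eq x]
  apply Real.sSup_le _ (tS_nonneg y)
  rintro _ ⟨t, ⟨ht, h2⟩, rfl⟩
  rw [tS_eq y]
  exact le_csSup (tS_bdd y) ⟨t, ⟨ht, le_trans h2 h⟩, rfl⟩

lemma tS_gap {a b : ℝ} (h : a ≤ b) (hd : ∀ t ∈ AA 0, ¬ (a < t ∧ t ≤ b)) :
    takagiS a = takagiS b := by
  rw [tS_eq, tS_eq]
  congr 2
  ext t
  constructor
  · rintro ⟨h1, h2⟩; exact ⟨h1, le_trans h2 h⟩
  · rintro ⟨h1, h2⟩; exact ⟨h1, not_lt.1 fun h3 => hd t h1 ⟨h3, h2⟩⟩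

lemma tS_zero : takagiS 0 = 0 := by
  rw [tS_of_mem (zero_mem_AA le_rfl), FF_zero]

lemma tS_neg {x : ℝ} (hx : x ≤ 0) : takagiS x = 0 :=
  le_antisymm (tS_zero ▸ tS_mono hx) (tS_nonneg x)

lemma tS_one : takagiS 1 = 1 := by
  refine le_antisymm (tS_le 1) (le_of_forall_pos_le_add fun ε hε => ?_)
  obtain ⟨s, hs, h⟩ := FF_dense (y := 1) zero_le_one le_rfl hε
  have h1 := tS_mono hs.1.2.le
  rw [tS_of_mem hs] at h1
  have := (abs_lt.1 h).1
  linarith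

lemma tS_big {x : ℝ} (hx : 1 ≤ x) : takagiS x = 1 :=
  le_antisymm (tS_le x) (tS_one ▸ tS_mono hx)

lemma tS_between {a b : ℝ} (h0 : 0 ≤ a) (hab : a < b) (h1 : b ≤ 1) :
    ∃ z, a < takagiS z ∧ takagiS z < b := by
  obtain ⟨s, hs, h⟩ := FF_dense (y := (a + b) / 2) (ε := (b - a) / 2) (by linarith) (by linarith)
    (by linarith)
  rw [abs_lt] at h
  refine ⟨s, ?_⟩
  rw [tS_of_mem hs]
  constructor <;> linarith [h.1, h.2]

lemma tS_cont : Continuous takagiS := by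
  rw [continuous_iff_continuousAt]
  intro x
  rw [tS_mono.continuousAt_iff_leftLim_eq_rightLim]
  have hL : 0 ≤ Function.leftLim takagiS x :=
    (tS_nonneg (x - 1)).trans (tS_mono.le_leftLim (by linarith))
  have hR : Function.rightLim takagiS x ≤ 1 :=
    (tS_mono.rightLim_le (by linarith)).trans (tS_le (x + 1))
  have h1 : Function.leftLim takagiS x ≤ takagiS x := tS_mono.leftLim_le le_rfl
  have h2 : takagiS x ≤ Function.rightLim takagiS x := tS_mono.le_rightLim le_rfl
  apply le_antisymm (h1.trans h2)
  have key : ∀ z, takagiS z ≤ Function.leftLim takagiS x ∨ takagiS z = takagiS x ∨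
      Function.rightLim takagiS x ≤ takagiS z := by
    intro z
    rcases lt_trichotomy z x with h | rfl | h
    · exact Or.inl (tS_mono.le_leftLim h)
    · exact Or.inr (Or.inl rfl)
    · exact Or.inr (Or.inr (tS_mono.rightLim_le h))
  by_contra hlt
  push Not at hlt
  rcases h1.lt_or_eq with h | h
  · obtain ⟨z, a, b⟩ := tS_between hL h (h2.trans hR)
    rcases key z with k | k | k <;> linarith
  · obtain ⟨z, a, b⟩ := tS_between (hL.trans h1) (h ▸ hlt) hR
    rcases key z with k | k | k <;> linarith

/-! ### The measure -/


lemma union_null_left {μ : Measure ℝ} {s t : Set ℝ} (h : μ t = 0) : μ (s ∪ t) = μ s := by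
  apply le_antisymm _ (measure_mono subset_union_left)
  simpa [h] using measure_union_le (μ := μ) s t

lemma mu_compl {μS : Measure ℝ}
    (hμS : ∀ a b : ℝ, a ≤ b → μS (Set.Ioc a b) = ENNReal.ofReal (takagiS b - takagiS a)) :
    μS (AA 0)ᶜ = 0 := by
  apply measure_null_of_locally_null
  intro x hx
  obtain ⟨ε, hε, hb⟩ := Metric.isOpen_iff.1 (AA_closed 0).isOpen_compl x hx
  refine ⟨Ioc (x - ε / 2) (x + ε / 2), mem_nhdsWithin_of_mem_nhds
    (Ioc_mem_nhds (by linarith) (by linarith)), ?_⟩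
  rw [hμS _ _ (by linarith), tS_gap (a := x - ε / 2) (b := x + ε / 2) (by linarith)]
  · simp
  · rintro t ht ⟨h1, h2⟩
    refine hb (a := t) ?_ ht
    rw [Metric.mem_ball, Real.dist_eq, abs_lt]
    constructor <;> linarith

lemma mu_atom {μS : Measure ℝ}
    (hμS : ∀ a b : ℝ, a ≤ b → μS (Set.Ioc a b) = ENNReal.ofReal (takagiS b - takagiS a))
    (x : ℝ) : μS {x} = 0 := by
  have h : Filter.Tendsto (fun n : ℕ => ENNReal.ofReal (takagiS x - takagiS (x - 1 / ((n : ℝ) + 1))))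
      Filter.atTop (nhds (ENNReal.ofReal (takagiS x - takagiS (x - 0)))) := by
    apply ENNReal.tendsto_ofReal
    apply Filter.Tendsto.const_sub
    exact (tS_cont.tendsto _).comp (Filter.Tendsto.const_sub _ tendsto_one_div_add_atTop_nhds_zero_nat)
  simp only [sub_zero, sub_self, ENNReal.ofReal_zero] at h
  refine le_antisymm (ge_of_tendsto' h fun n => ?_) (zero_le)
  have hp : (0 : ℝ) < 1 / ((n : ℝ) + 1) := by positivity
  rw [← hμS _ _ (by linarith)]
  apply measure_mono
  rintro _ rfl
  exact ⟨by linarith, le_rfl⟩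

lemma mu_fibre {μS : Measure ℝ}
    (hμS : ∀ a b : ℝ, a ≤ b → μS (Set.Ioc a b) = ENNReal.ofReal (takagiS b - takagiS a))
    (y : ℝ) : μS (takagiS ⁻¹' {y}) = 0 := by
  have hS : IsCompact (takagiS ⁻¹' {y} ∩ AA 0) := by
    apply IsCompact.of_isClosed_subset (isCompact_Icc (a := (0 : ℝ)) (b := 1))
    · exact (isClosed_singleton.preimage tS_cont).inter (AA_closed 0)
    · exact fun x hx => ⟨hx.2.1.1, hx.2.1.2.le⟩
  have h0 : μS (takagiS ⁻¹' {y} ∩ AA 0) = 0 := by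
    rcases (takagiS ⁻¹' {y} ∩ AA 0).eq_empty_or_nonempty with he | hne
    · rw [he]; simp
    obtain ⟨a, ha⟩ := hS.exists_isLeast hne
    obtain ⟨b, hb⟩ := hS.exists_isGreatest hne
    have hab : a ≤ b := ha.2 hb.1
    refine measure_mono_null (t := {a} ∪ Ioc a b) ?_ (measure_union_null (mu_atom hμS a) ?_)
    · intro z hz
      rcases (ha.2 hz).eq_or_lt with h | h
      · left; exact h.symm
      · right; exact ⟨h, hb.2 hz⟩
    · rw [hμS _ _ hab]
      have e1 : takagiS a = y := ha.1.1
      have e2 : takagiS b = y := hb.1.1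
      simp [e1, e2]
  refine measure_mono_null (t := (takagiS ⁻¹' {y} ∩ AA 0) ∪ (AA 0)ᶜ) ?_
    (measure_union_null h0 (mu_compl hμS))
  intro z hz
  by_cases h : z ∈ AA 0
  · exact Or.inl ⟨hz, h⟩
  · exact Or.inr h

lemma mu_Icc {μS : Measure ℝ}
    (hμS : ∀ a b : ℝ, a ≤ b → μS (Set.Ioc a b) = ENNReal.ofReal (takagiS b - takagiS a))
    {x : ℝ} (hx : 0 ≤ x) : μS (Icc 0 x) = ENNReal.ofReal (takagiS x) := by
  rw [← Ioc_union_left hx, union_null_left, hμS _ _ hx, tS_zero, sub_zero]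
  exact mu_atom hμS 0

lemma mu_of_superset {μS : Measure ℝ}
    (hμS : ∀ a b : ℝ, a ≤ b → μS (Set.Ioc a b) = ENNReal.ofReal (takagiS b - takagiS a))
    {s : Set ℝ} (hs : AA 0 ⊆ s) : μS s = 1 := by
  have h1 : ∀ s : Set ℝ, AA 0 ⊆ s → μS s = μS univ := fun s hs =>
    measure_congr (ae_eq_univ.2 (measure_mono_null (compl_subset_compl.2 hs) (mu_compl hμS)))
  rw [h1 s hs, ← h1 (Icc 0 1) (fun x hx => ⟨hx.1.1, hx.1.2.le⟩), mu_Icc hμS zero_le_one, tS_one]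
  simp

lemma mu_map {μS : Measure ℝ}
    (hμS : ∀ a b : ℝ, a ≤ b → μS (Set.Ioc a b) = ENNReal.ofReal (takagiS b - takagiS a)) :
    Measure.map takagiS μS = volume.restrict (Icc (0 : ℝ) 1) := by
  have hf : IsFiniteMeasure μS := ⟨by
    rw [mu_of_superset hμS (subset_univ _)]; exact ENNReal.one_lt_top⟩
  have hm := tS_cont.measurable
  apply Measure.ext_of_Iic
  intro y
  rw [Measure.map_apply hm measurableSet_Iic, Measure.restrict_apply measurableSet_Iic]
  rcases lt_or_ge y 0 with h | h
  · have e1 : takagiS ⁻¹' Iic y = ∅ := by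
      ext z; simp only [mem_preimage, mem_Iic, mem_empty_iff_false, iff_false]
      have := tS_nonneg z
      intro hc; linarith
    have e2 : Iic y ∩ Icc (0 : ℝ) 1 = ∅ := by
      ext z; simp only [mem_inter_iff, mem_Iic, mem_Icc, mem_empty_iff_false, iff_false]
      rintro ⟨h1, h2, -⟩; linarith
    rw [e1, e2]; simp
  rcases le_or_gt 1 y with h' | h'
  · rw [mu_of_superset hμS]
    · have : Iic y ∩ Icc (0 : ℝ) 1 = Icc 0 1 := by
        ext z; simp only [mem_inter_iff, mem_Iic, mem_Icc, and_iff_right_iff_imp]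
        rintro ⟨h1, h2⟩; linarith
      rw [this]; simp
    · intro z _
      exact (tS_le z).trans h'
  · obtain ⟨x, ⟨hx0, hx1⟩, hxy⟩ := intermediate_value_Icc (zero_le_one (α := ℝ))
      tS_cont.continuousOn (show y ∈ Icc (takagiS 0) (takagiS 1) by
        rw [tS_zero, tS_one]; exact ⟨h, h'.le⟩)
    have : Iic y ∩ Icc (0 : ℝ) 1 = Icc 0 y := by
      ext z; simp only [mem_inter_iff, mem_Iic, mem_Icc]
      constructor
      · rintro ⟨h1, h2, h3⟩; exact ⟨h2, h1⟩
      · rintro ⟨h1, h2⟩; exact ⟨h2, h1, by linarith⟩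
    rw [this, Real.volume_Icc, sub_zero, ← hxy, ← mu_Icc hμS hx0]
    apply le_antisymm
    · have : takagiS ⁻¹' Iic (takagiS x) ⊆ (Icc 0 x ∪ takagiS ⁻¹' {takagiS x}) ∪ (AA 0)ᶜ := by
        intro z hz
        by_cases hzA : z ∈ AA 0
        · left
          rcases le_or_gt z x with hzx | hzx
          · exact Or.inl ⟨hzA.1.1, hzx⟩
          · exact Or.inr (le_antisymm hz (tS_mono hzx.le))
        · exact Or.inr hzA
      refine (measure_mono this).trans ?_
      rw [union_null_left (mu_compl hμS),
        union_null_left (mu_fibre hμS _)]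
    · exact measure_mono fun z hz => tS_mono hz.2

lemma mu_image {μS : Measure ℝ}
    (hμS : ∀ a b : ℝ, a ≤ b → μS (Set.Ioc a b) = ENNReal.ofReal (takagiS b - takagiS a))
    {K : Set ℝ} (hK : MeasurableSet K) : μS K = volume (takagiS '' K) := by
  have hm := tS_cont.measurable
  have hc := tS_mono.countable_setOfPred_two_preimages
  set T : Set ℝ := {c | ∃ x y, x < y ∧ takagiS x = c ∧ takagiS y = c} with hT
  have hTm : MeasurableSet T := hc.measurableSet
  have hC : μS (takagiS ⁻¹' T) = 0 := by
    rw [← biUnion_preimage_singleton]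
    exact (measure_biUnion_null_iff hc).2 fun y _ => mu_fibre hμS y
  have hinj : ∀ x z, takagiS x ∉ T → takagiS z = takagiS x → z = x := by
    intro x z hx h
    by_contra hne
    rcases lt_or_gt_of_ne hne with h2 | h2
    · exact hx ⟨z, x, h2, h, rfl⟩
    · exact hx ⟨x, z, h2, rfl, h⟩
  have hKm : MeasurableSet (K \ takagiS ⁻¹' T) := hK.diff (hm hTm)
  have him : MeasurableSet (takagiS '' (K \ takagiS ⁻¹' T)) :=
    hKm.image_of_continuousOn_injOn tS_cont.continuousOn
      (fun x hx z hz h => (hinj x z hx.2 h.symm).symm)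
  have e1 : μS K = μS (K \ takagiS ⁻¹' T) := (measure_sdiff_null hC).symm
  have e2 : volume (takagiS '' K) = volume (takagiS '' (K \ takagiS ⁻¹' T)) := by
    have : takagiS '' (K \ takagiS ⁻¹' T) = takagiS '' K \ T := by
      ext y; constructor
      · rintro ⟨x, ⟨h1, h2⟩, rfl⟩; exact ⟨⟨x, h1, rfl⟩, h2⟩
      · rintro ⟨⟨x, h1, rfl⟩, h2⟩; exact ⟨x, ⟨h1, h2⟩, rfl⟩
    rw [this, measure_sdiff_null (hc.measure_zero volume)]
  have e3 : takagiS ⁻¹' (takagiS '' (K \ takagiS ⁻¹' T)) = K \ takagiS ⁻¹' T := by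
    apply Subset.antisymm _ (subset_preimage_image _ _)
    rintro z ⟨x, hx, h⟩
    rwa [hinj x z hx.2 h.symm]
  rw [e1, e2]
  conv_lhs => rw [← e3, ← Measure.map_apply hm him, mu_map hμS, Measure.restrict_apply him]
  congr 1
  apply inter_eq_left.2
  rintro _ ⟨x, -, rfl⟩
  exact ⟨tS_nonneg x, tS_le x⟩

/-- The Takagi singular measure: total mass, singularity, support, and image formula. -/
theorem takagiSingularMeasure_properties (μS : MeasureTheory.Measure ℝ)
    (hμS : ∀ a b : ℝ, a ≤ b → μS (Set.Ioc a b) = ENNReal.ofReal (takagiS b - takagiS a)) :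
    μS (Set.Icc (0 : ℝ) 1) = 1 ∧ μS OmegaL = 1 ∧
      μS ⟂ₘ (MeasureTheory.volume : MeasureTheory.Measure ℝ) ∧
      {x : ℝ | ∀ U : Set ℝ, IsOpen U → x ∈ U → 0 < μS U} = OmegaL ∧
      ∀ K : Set ℝ, K ⊆ Set.Icc (0 : ℝ) 1 → MeasurableSet K →
        μS K = MeasureTheory.volume (takagiS '' K) := by
  rw [← AA_zero]
  refine ⟨mu_of_superset hμS fun x hx => ⟨hx.1.1, hx.1.2.le⟩, mu_of_superset hμS Subset.rfl,
    ⟨(AA 0)ᶜ, (AA_closed 0).measurableSet.compl, mu_compl hμS, by rw [compl_compl]; exact vol_zero⟩,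
    ?_, fun K _ hK => mu_image hμS hK⟩
  ext x
  constructor
  · intro h
    by_contra hx
    exact (h _ (AA_closed 0).isOpen_compl hx).ne' (mu_compl hμS)
  · intro hx U hU hxU
    obtain ⟨ε, hε, hb⟩ := Metric.isOpen_iff.1 hU x hxU
    obtain ⟨n, hn⟩ := exists_pow_lt_of_lt_one hε (by norm_num : (1 / 2 : ℝ) < 1)
    rw [one_div_pow] at hn
    obtain ⟨s, hs, t, ht, a, b, c, e⟩ := FF_strict n 0 x hx
    have h1 : 0 < μS (Ioc s t) := by
      rw [hμS _ _ c.le, ENNReal.ofReal_pos, tS_of_mem hs, tS_of_mem ht]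
      linarith
    refine lt_of_lt_of_le h1 (measure_mono fun z hz => hb ?_)
    rw [Metric.mem_ball, Real.dist_eq, abs_lt]
    rw [abs_le] at a b
    constructor <;> linarith [hz.1, hz.2]
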